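/- Let ψ₁ be the modified stream function, i.e. an axially symmetric smooth solution of −ψ_{1,rr} − (3/r)ψ_{1,r} − ψ_{1,zz} = Γ in Ω with ψ₁ = 0 on S, where Γ is axially symmetric, smooth, and vanishes on S, and ψ₁ admits the expansion ψ₁ = d₁(z) + d₂(z)r² + … near the axis. Then there is a constant c > 0 such that |ψ_{1,rz}/r|_{2,Ω} ≤ c |Γ_{,z}|_{2,Ω}. -/

import Mathlib

open MeasureTheory Real Set
open scoped ENNReal

noncomputable section

/-- The half-strip `(0,R) × (-a,a)` of `(r,z)` coordinates describing the cylinder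
`Ω = {x ∈ ℝ³ : x₁² + x₂² < R², |x₃| < a}`. -/
def cylStrip (R a : ℝ) : Set (ℝ × ℝ) := Ioo 0 R ×ˢ Ioo (-a) a

/-- The measure on the `(r,z)` half-strip corresponding to Lebesgue measure on the
cylinder `Ω` for axially symmetric integrands: `dμ = 2π r dr dz`. -/
def cylMeas (R a : ℝ) : Measure (ℝ × ℝ) :=
  ((volume : Measure (ℝ × ℝ)).restrict (cylStrip R a)).withDensity
    fun q => ENNReal.ofReal (2 * π * q.1)

/-- `∂_r` of a function of `(r,z)`. -/
def qdr (w : ℝ → ℝ → ℝ) : ℝ → ℝ → ℝ := fun r z => deriv (fun s => w s z) r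
/-- `∂_z` of a function of `(r,z)`. -/
def qdz (w : ℝ → ℝ → ℝ) : ℝ → ℝ → ℝ := fun r z => deriv (fun s => w r s) z

/-- Hypotheses on the modified stream function `ψ₁` and the datum `Γ`:
smoothness, axial symmetry (built in: functions of `(r,z)`), the equation
`−ψ₁,rr − (3/r)ψ₁,r − ψ₁,zz = Γ` in `Ω`, `ψ₁ = 0` and `Γ = 0` on `S`, and the
behaviour `ψ₁,r, ψ₁,rz, ψ₁,rzz = O(r)` near the axis coming from the expansion
`ψ₁ = d₁(z) + d₂(z) r² + …`. -/
structure ModStream (R a : ℝ) (ψ Γ : ℝ → ℝ → ℝ) : Prop where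
  smooth_ψ : ∀ n : ℕ, ContDiff ℝ n (fun q : ℝ × ℝ => ψ q.1 q.2)
  smooth_Γ : ∀ n : ℕ, ContDiff ℝ n (fun q : ℝ × ℝ => Γ q.1 q.2)
  eqn : ∀ r z, (r, z) ∈ cylStrip R a →
    - qdr (qdr ψ) r z - (3 / r) * qdr ψ r z - qdz (qdz ψ) r z = Γ r z
  ψ_lat : ∀ z ∈ Icc (-a) a, ψ R z = 0
  ψ_top : ∀ r ∈ Icc (0:ℝ) R, ψ r a = 0 ∧ ψ r (-a) = 0
  Γ_lat : ∀ z ∈ Icc (-a) a, Γ R z = 0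
  Γ_top : ∀ r ∈ Icc (0:ℝ) R, Γ r a = 0 ∧ Γ r (-a) = 0
  axis : ∃ C : ℝ, ∀ r ∈ Ioo (0:ℝ) R, ∀ z ∈ Icc (-a) a,
    |qdr ψ r z| ≤ C * r ∧ |qdr (qdz ψ) r z| ≤ C * r ∧ |qdr (qdz (qdz ψ)) r z| ≤ C * r

open scoped ContDiff

section PartialDerivatives

variable {w : ℝ → ℝ → ℝ}

lemma hasDerivAt_qdr (hw : ContDiff ℝ ∞ (fun q : ℝ × ℝ => w q.1 q.2)) (r z : ℝ) :
    HasDerivAt (fun s => w s z) (qdr w r z) r := by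
  have h : DifferentiableAt ℝ (fun s => (fun q : ℝ × ℝ => w q.1 q.2) (s, z)) r :=
    (hw.differentiable (by simp)).comp (by fun_prop : Differentiable ℝ fun s : ℝ => (s, z)) r
  exact h.hasDerivAt

lemma hasDerivAt_qdz (hw : ContDiff ℝ ∞ (fun q : ℝ × ℝ => w q.1 q.2)) (r z : ℝ) :
    HasDerivAt (fun s => w r s) (qdz w r z) z := by
  have h : DifferentiableAt ℝ (fun s => (fun q : ℝ × ℝ => w q.1 q.2) (r, s)) z :=
    (hw.differentiable (by simp)).comp (by fun_prop : Differentiable ℝ fun s : ℝ => (r, s)) z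
  exact h.hasDerivAt

lemma fderiv_apply_qdr (hw : ContDiff ℝ ∞ (fun q : ℝ × ℝ => w q.1 q.2)) (q : ℝ × ℝ) :
    fderiv ℝ (fun q : ℝ × ℝ => w q.1 q.2) q (1, 0) = qdr w q.1 q.2 := by
  have h1 : HasDerivAt (fun s : ℝ => (s, q.2)) ((1 : ℝ), (0 : ℝ)) q.1 :=
    (hasDerivAt_id _).prodMk (hasDerivAt_const _ _)
  have h2 := ((hw.differentiable (by simp)) (q.1, q.2)).hasFDerivAt.comp_hasDerivAt q.1 h1
  exact h2.unique (hasDerivAt_qdr hw q.1 q.2)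

lemma fderiv_apply_qdz (hw : ContDiff ℝ ∞ (fun q : ℝ × ℝ => w q.1 q.2)) (q : ℝ × ℝ) :
    fderiv ℝ (fun q : ℝ × ℝ => w q.1 q.2) q (0, 1) = qdz w q.1 q.2 := by
  have h1 : HasDerivAt (fun s : ℝ => (q.1, s)) ((0 : ℝ), (1 : ℝ)) q.2 :=
    (hasDerivAt_const _ _).prodMk (hasDerivAt_id _)
  have h2 := ((hw.differentiable (by simp)) (q.1, q.2)).hasFDerivAt.comp_hasDerivAt q.2 h1
  exact h2.unique (hasDerivAt_qdz hw q.1 q.2)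

lemma contDiff_qdr (hw : ContDiff ℝ ∞ (fun q : ℝ × ℝ => w q.1 q.2)) :
    ContDiff ℝ ∞ (fun q : ℝ × ℝ => qdr w q.1 q.2) := by
  simp_rw [← fderiv_apply_qdr hw]
  exact (hw.fderiv_right (by simp)).clm_apply contDiff_const

lemma contDiff_qdz (hw : ContDiff ℝ ∞ (fun q : ℝ × ℝ => w q.1 q.2)) :
    ContDiff ℝ ∞ (fun q : ℝ × ℝ => qdz w q.1 q.2) := by
  simp_rw [← fderiv_apply_qdz hw]
  exact (hw.fderiv_right (by simp)).clm_apply contDiff_const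

lemma qdz_qdr_comm (hw : ContDiff ℝ ∞ (fun q : ℝ × ℝ => w q.1 q.2)) :
    qdz (qdr w) = qdr (qdz w) := by
  have hd : Differentiable ℝ (fderiv ℝ (fun q : ℝ × ℝ => w q.1 q.2)) :=
    (hw.fderiv_right (m := ∞) (by simp)).differentiable (by simp)
  have hsymm (q : ℝ × ℝ) : IsSymmSndFDerivAt ℝ (fun q : ℝ × ℝ => w q.1 q.2) q :=
    (contDiff_infty.1 hw 2).contDiffAt.isSymmSndFDerivAt (by simp)
  funext r z
  have h1 := fderiv_apply_qdz (contDiff_qdr hw) (r, z)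
  have h2 := fderiv_apply_qdr (contDiff_qdz hw) (r, z)
  simp_rw [← fderiv_apply_qdr hw] at h1
  simp_rw [← fderiv_apply_qdz hw] at h2
  rw [fderiv_clm_apply (hd _) (by fun_prop)] at h1 h2
  simp only [fderiv_fun_const, Pi.zero_apply, ContinuousLinearMap.comp_zero, zero_add,
    ContinuousLinearMap.flip_apply] at h1 h2
  rw [← h1, ← h2]
  exact hsymm _ _ _

end PartialDerivatives

lemma setIntegral_cylStrip_divergence_nonpos {R a : ℝ} (hR : 0 < R) (ha : 0 < a)
    {P Q : ℝ → ℝ → ℝ} (hP : ContDiff ℝ ∞ (fun q : ℝ × ℝ => P q.1 q.2))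
    (hQ : ContDiff ℝ ∞ (fun q : ℝ × ℝ => Q q.1 q.2))
    (hPle : ∀ z ∈ Icc (-a) a, P R z ≤ P 0 z)
    (hQ0 : ∀ r ∈ Icc 0 R, Q r a = 0 ∧ Q r (-a) = 0) :
    ∫ q in cylStrip R a, (qdr P q.1 q.2 + qdz Q q.1 q.2) ≤ 0 := by
  have hcP := (contDiff_qdr hP).continuous
  have hcQ := (contDiff_qdz hQ).continuous
  have haa : -a ≤ a := by linarith
  have hae : cylStrip R a =ᵐ[volume] Icc ((0 : ℝ), -a) (R, a) := by
    rw [← Icc_prod_Icc]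
    exact Measure.set_prod_ae_eq Ioo_ae_eq_Icc Ioo_ae_eq_Icc
  have hdiv := integral_divergence_prod_Icc_of_hasFDerivAt_of_le
    (fun q : ℝ × ℝ => P q.1 q.2) (fun q : ℝ × ℝ => Q q.1 q.2)
    (fderiv ℝ fun q : ℝ × ℝ => P q.1 q.2) (fderiv ℝ fun q : ℝ × ℝ => Q q.1 q.2)
    ((0 : ℝ), -a) (R, a) ⟨hR.le, haa⟩
    hP.continuous.continuousOn hQ.continuous.continuousOn
    (fun x _ => (hP.differentiable (by simp) x).hasFDerivAt)
    (fun x _ => (hQ.differentiable (by simp) x).hasFDerivAt)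
    (by
      simp_rw [fderiv_apply_qdr hP, fderiv_apply_qdz hQ]
      exact (hcP.add hcQ).continuousOn.integrableOn_compact isCompact_Icc)
  simp_rw [fderiv_apply_qdr hP, fderiv_apply_qdz hQ] at hdiv
  rw [setIntegral_congr_set hae, hdiv]
  have hzero (b : ℝ) (hb : ∀ r ∈ Icc 0 R, Q r b = 0) : ∫ r in (0 : ℝ)..R, Q r b = 0 := by
    rw [intervalIntegral.integral_congr (g := fun _ => 0)
      (fun r hr => hb r (by rwa [uIcc_of_le hR.le] at hr))]
    simp
  have hmono : ∫ z in (-a)..a, P R z ≤ ∫ z in (-a)..a, P 0 z := by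
    have hc (r : ℝ) : Continuous (fun z => P r z) :=
      hP.continuous.comp (by fun_prop : Continuous fun z : ℝ => (r, z))
    exact intervalIntegral.integral_mono_on haa ((hc R).intervalIntegrable _ _)
      ((hc 0).intervalIntegrable _ _) hPle
  rw [hzero a fun r hr => (hQ0 r hr).1, hzero (-a) fun r hr => (hQ0 r hr).2]
  linarith

lemma integral_cylMeas (R a : ℝ) (f : ℝ × ℝ → ℝ) :
    ∫ q, f q ∂(cylMeas R a) = ∫ q in cylStrip R a, 2 * π * q.1 * f q := by
  have hms : MeasurableSet (cylStrip R a) := measurableSet_Ioo.prod measurableSet_Ioo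
  rw [cylMeas, integral_withDensity_eq_integral_toReal_smul (by fun_prop)
    (Filter.Eventually.of_forall fun _ => ENNReal.ofReal_lt_top)]
  refine setIntegral_congr_fun hms fun q hq => ?_
  have hq1 : 0 < q.1 := hq.1.1
  simp only [smul_eq_mul]
  rw [ENNReal.toReal_ofReal (by positivity)]

namespace ModStream

variable {R a : ℝ} {ψ Γ : ℝ → ℝ → ℝ}

lemma contDiff_ψ (h : ModStream R a ψ Γ) : ContDiff ℝ ∞ (fun q : ℝ × ℝ => ψ q.1 q.2) :=
  contDiff_infty.2 h.smooth_ψ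

lemma contDiff_Γ (h : ModStream R a ψ Γ) : ContDiff ℝ ∞ (fun q : ℝ × ℝ => Γ q.1 q.2) :=
  contDiff_infty.2 h.smooth_Γ

lemma eqn_qdz (h : ModStream R a ψ Γ) {r z : ℝ} (hrz : (r, z) ∈ cylStrip R a) :
    - qdr (qdr (qdz ψ)) r z - (3 / r) * qdr (qdz ψ) r z - qdz (qdz (qdz ψ)) r z
      = qdz Γ r z := by
  have hψ := h.contDiff_ψ
  have h1 := hasDerivAt_qdz (contDiff_qdr (contDiff_qdr hψ)) r z
  have h2 := hasDerivAt_qdz (contDiff_qdr hψ) r z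
  have h3 := hasDerivAt_qdz (contDiff_qdz (contDiff_qdz hψ)) r z
  rw [qdz_qdr_comm (contDiff_qdr hψ), qdz_qdr_comm hψ] at h1
  rw [qdz_qdr_comm hψ] at h2
  have hd := (h1.neg.sub (h2.const_mul (3 / r))).sub h3
  have hev : (fun s => Γ r s) =ᶠ[nhds z]
      fun s => - qdr (qdr ψ) r s - (3 / r) * qdr ψ r s - qdz (qdz ψ) r s := by
    filter_upwards [Ioo_mem_nhds hrz.2.1 hrz.2.2] with s hs
    exact (h.eqn r s ⟨hrz.1, hs⟩).symm
  exact (hd.congr_of_eventuallyEq hev).unique (hasDerivAt_qdz h.contDiff_Γ r z)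

lemma qdz_qdz_eq_zero_of_forall_eq_zero {b : ℝ} (h : ModStream R a ψ Γ) (hR : 0 < R)
    (hb : b ∈ closure (Ioo (-a) a))
    (hψb : ∀ r ∈ Icc 0 R, ψ r b = 0) (hΓb : ∀ r ∈ Icc 0 R, Γ r b = 0) :
    ∀ r ∈ Icc 0 R, qdz (qdz ψ) r b = 0 := by
  have hψ := h.contDiff_ψ
  have hcz {w : ℝ → ℝ → ℝ} (hw : ContDiff ℝ ∞ (fun q : ℝ × ℝ => w q.1 q.2)) (r : ℝ) :
      Continuous (fun z => w r z) :=
    hw.continuous.comp (by fun_prop : Continuous fun z : ℝ => (r, z))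
  have hcr : Continuous (fun r => qdz (qdz ψ) r b) :=
    (contDiff_qdz (contDiff_qdz hψ)).continuous.comp
      (by fun_prop : Continuous fun r : ℝ => (r, b))
  have hIoo : EqOn (fun r => qdz (qdz ψ) r b) (fun _ => 0) (Ioo 0 R) := by
    intro r hr
    have hr1 (s : ℝ) (hs : s ∈ Ioo 0 R) : qdr ψ s b = 0 := by
      have hev : (fun t => ψ t b) =ᶠ[nhds s] fun _ => 0 := by
        filter_upwards [Ioo_mem_nhds hs.1 hs.2] with t ht
        exact hψb t (Ioo_subset_Icc_self ht)
      exact hev.deriv_eq.trans (deriv_const s 0)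
    have hr2 : qdr (qdr ψ) r b = 0 := by
      have hev : (fun t => qdr ψ t b) =ᶠ[nhds r] fun _ => 0 := by
        filter_upwards [Ioo_mem_nhds hr.1 hr.2] with t ht using hr1 t ht
      exact hev.deriv_eq.trans (deriv_const r 0)
    have heq : EqOn
        (fun z => - qdr (qdr ψ) r z - (3 / r) * qdr ψ r z - qdz (qdz ψ) r z)
        (fun z => Γ r z) (Ioo (-a) a) := fun z hz => h.eqn r z ⟨hr, hz⟩
    have heqb := heq.closure
      (((hcz (contDiff_qdr (contDiff_qdr hψ)) r).neg.sub
        (continuous_const.mul (hcz (contDiff_qdr hψ) r))).sub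
        (hcz (contDiff_qdz (contDiff_qdz hψ)) r)) (hcz h.contDiff_Γ r) hb
    simp only [hr1 r hr, hr2, hΓb r (Ioo_subset_Icc_self hr)] at heqb
    simpa using heqb
  intro r hr
  rw [← closure_Ioo hR.ne] at hr
  exact hIoo.closure hcr continuous_const hr

lemma qdz_qdz_lateral (h : ModStream R a ψ Γ) (ha : 0 < a) :
    ∀ z ∈ Icc (-a) a, qdz (qdz ψ) R z = 0 := by
  have h1 (s : ℝ) (hs : s ∈ Ioo (-a) a) : qdz ψ R s = 0 := by
    have hev : (fun t => ψ R t) =ᶠ[nhds s] fun _ => 0 := by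
      filter_upwards [Ioo_mem_nhds hs.1 hs.2] with t ht
      exact h.ψ_lat t (Ioo_subset_Icc_self ht)
    exact hev.deriv_eq.trans (deriv_const s 0)
  have h2 : EqOn (fun z => qdz (qdz ψ) R z) (fun _ => 0) (Ioo (-a) a) := by
    intro z hz
    have hev : (fun t => qdz ψ R t) =ᶠ[nhds z] fun _ => 0 := by
      filter_upwards [Ioo_mem_nhds hz.1 hz.2] with t ht using h1 t ht
    exact hev.deriv_eq.trans (deriv_const z 0)
  have hc : Continuous (fun z => qdz (qdz ψ) R z) :=
    (contDiff_qdz (contDiff_qdz h.contDiff_ψ)).continuous.comp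
      (by fun_prop : Continuous fun z : ℝ => (R, z))
  intro z hz
  rw [← closure_Ioo (by linarith : -a ≠ a)] at hz
  exact h2.closure hc continuous_const hz

lemma qdr_qdz_axis (h : ModStream R a ψ Γ) (hR : 0 < R) :
    ∀ z ∈ Icc (-a) a, qdr (qdz ψ) 0 z = 0 := by
  obtain ⟨C, hC⟩ := h.axis
  intro z hz
  have hc : Continuous (fun r => |qdr (qdz ψ) r z|) :=
    ((contDiff_qdr (contDiff_qdz h.contDiff_ψ)).continuous.comp
      (by fun_prop : Continuous fun r : ℝ => (r, z))).abs
  have hle : |qdr (qdz ψ) 0 z| ≤ C * 0 :=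
    le_on_closure (s := Ioo 0 R) (f := fun r => |qdr (qdz ψ) r z|) (g := fun r => C * r)
      (fun r hr => (hC r hr z hz).2.1) hc.continuousOn (by fun_prop)
      (by rw [closure_Ioo hR.ne]; exact left_mem_Icc.2 hR.le)
  rw [mul_zero] at hle
  exact abs_eq_zero.1 (le_antisymm hle (abs_nonneg _))

lemma pointwise_bound (h : ModStream R a ψ Γ) {q : ℝ × ℝ} (hq : q ∈ cylStrip R a) :
    2 * π * q.1 * (qdr (qdz ψ) q.1 q.2 / q.1) ^ 2 ≤
      (1 / 3) ^ 2 * (2 * π * q.1 * qdz Γ q.1 q.2 ^ 2) + 4 * π / 3 *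
        (qdr (fun r z => (qdz (qdz ψ) r z ^ 2 - qdr (qdz ψ) r z ^ 2) / 2) q.1 q.2
        + qdz (fun r z => -(qdz (qdz ψ) r z * qdr (qdz ψ) r z)) q.1 q.2) := by
  obtain ⟨r, z⟩ := q
  have hu := contDiff_qdz h.contDiff_ψ
  have hr : 0 < r := hq.1.1
  have hP : qdr (fun r z => (qdz (qdz ψ) r z ^ 2 - qdr (qdz ψ) r z ^ 2) / 2) r z =
      qdz (qdz ψ) r z * qdr (qdz (qdz ψ)) r z
        - qdr (qdz ψ) r z * qdr (qdr (qdz ψ)) r z := by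
    refine (((((hasDerivAt_qdr (contDiff_qdz hu) r z).pow 2).sub
      ((hasDerivAt_qdr (contDiff_qdr hu) r z).pow 2)).div_const 2).deriv).trans ?_
    norm_num
    ring
  have hQ : qdz (fun r z => -(qdz (qdz ψ) r z * qdr (qdz ψ) r z)) r z =
      -(qdz (qdz (qdz ψ)) r z * qdr (qdz ψ) r z
        + qdz (qdz ψ) r z * qdr (qdz (qdz ψ)) r z) := by
    rw [← qdz_qdr_comm hu]
    exact ((hasDerivAt_qdz (contDiff_qdz hu) r z).mul
      (hasDerivAt_qdz (contDiff_qdr hu) r z)).neg.deriv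
  simp only
  rw [hP, hQ, ← h.eqn_qdz hq]
  generalize qdr (qdz ψ) r z = A, qdr (qdr (qdz ψ)) r z = B, qdz (qdz (qdz ψ)) r z = D,
    qdz (qdz ψ) r z = E, qdr (qdz (qdz ψ)) r z = F
  have hsq : 0 ≤ 2 * π / 9 * r * (B + D) ^ 2 := by positivity
  have hid : (1 / 3) ^ 2 * (2 * π * r * (-B - 3 / r * A - D) ^ 2) + 4 * π / 3 *
      (E * F - A * B + -(D * A + E * F)) - 2 * π * r * (A / r) ^ 2
      = 2 * π / 9 * r * (B + D) ^ 2 := by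
    field_simp
    ring
  linarith

end ModStream

/-- weighted estimate `|ψ₁,rz/r|_{2,Ω} ≤ c |Γ,z|_{2,Ω}`: there is `c > 0`,
depending only on the cylinder, such that for every modified stream function `ψ₁` with
datum `Γ`, `|ψ₁,rz/r|_{2,Ω} ≤ c |Γ,z|_{2,Ω}`. -/
theorem stmt_9 (R a : ℝ) (hR : 0 < R) (ha : 0 < a) :
    ∃ c > 0, ∀ ψ Γ : ℝ → ℝ → ℝ, ModStream R a ψ Γ →
      Real.sqrt (∫ q, (qdr (qdz ψ) q.1 q.2 / q.1) ^ 2 ∂(cylMeas R a))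
        ≤ c * Real.sqrt (∫ q, (qdz Γ q.1 q.2) ^ 2 ∂(cylMeas R a)) := by
  refine ⟨1 / 3, by norm_num, fun ψ Γ h => ?_⟩
  have hms : MeasurableSet (cylStrip R a) := measurableSet_Ioo.prod measurableSet_Ioo
  have hu := contDiff_qdz h.contDiff_ψ
  have hA := contDiff_qdr hu
  have hE := contDiff_qdz hu
  have hP : ContDiff ℝ ∞ (fun q : ℝ × ℝ =>
      (fun r z => (qdz (qdz ψ) r z ^ 2 - qdr (qdz ψ) r z ^ 2) / 2) q.1 q.2) :=
    ((hE.pow 2).sub (hA.pow 2)).div_const 2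
  have hQ : ContDiff ℝ ∞ (fun q : ℝ × ℝ =>
      (fun r z => -(qdz (qdz ψ) r z * qdr (qdz ψ) r z)) q.1 q.2) := (hE.mul hA).neg
  have hclo : closure (Ioo (-a) a) = Icc (-a) a := closure_Ioo (by linarith)
  have hdiv := setIntegral_cylStrip_divergence_nonpos hR ha
    (P := fun r z => (qdz (qdz ψ) r z ^ 2 - qdr (qdz ψ) r z ^ 2) / 2)
    (Q := fun r z => -(qdz (qdz ψ) r z * qdr (qdz ψ) r z)) hP hQ
    (fun z hz => by
      simp only [h.qdz_qdz_lateral ha z hz, h.qdr_qdz_axis hR z hz]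
      nlinarith [sq_nonneg (qdr (qdz ψ) R z), sq_nonneg (qdz (qdz ψ) 0 z)])
    (fun r hr => by
      simp only [h.qdz_qdz_eq_zero_of_forall_eq_zero hR
          (by rw [hclo]; exact right_mem_Icc.2 (by linarith))
          (fun r hr => (h.ψ_top r hr).1) (fun r hr => (h.Γ_top r hr).1) r hr,
        h.qdz_qdz_eq_zero_of_forall_eq_zero hR
          (by rw [hclo]; exact left_mem_Icc.2 (by linarith))
          (fun r hr => (h.ψ_top r hr).2) (fun r hr => (h.Γ_top r hr).2) r hr]
      simp)
  have hint {f : ℝ × ℝ → ℝ} (hf : Continuous f) : IntegrableOn f (cylStrip R a) :=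
    (hf.continuousOn.integrableOn_compact (isCompact_Icc.prod isCompact_Icc)).mono_set
      (prod_mono Ioo_subset_Icc_self Ioo_subset_Icc_self)
  have hg := (contDiff_qdz h.contDiff_Γ).continuous
  have hi1 := (hint (f := fun q => 2 * π * q.1 * qdz Γ q.1 q.2 ^ 2)
    (by fun_prop)).const_mul ((1 / 3 : ℝ) ^ 2)
  have hi2 := (hint ((contDiff_qdr
      (w := fun r z => (qdz (qdz ψ) r z ^ 2 - qdr (qdz ψ) r z ^ 2) / 2) hP).continuous.add
    (contDiff_qdz
      (w := fun r z => -(qdz (qdz ψ) r z * qdr (qdz ψ) r z)) hQ).continuous)).const_mul (4 * π / 3)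
  have hmain : ∫ q, (qdr (qdz ψ) q.1 q.2 / q.1) ^ 2 ∂(cylMeas R a) ≤
      (1 / 3) ^ 2 * ∫ q, (qdz Γ q.1 q.2) ^ 2 ∂(cylMeas R a) := by
    rw [integral_cylMeas, integral_cylMeas]
    have hmono := integral_mono_of_nonneg
      ((ae_restrict_iff' hms).2 (Filter.Eventually.of_forall fun q hq => by
        have hq1 : 0 < q.1 := hq.1.1
        show (0 : ℝ) ≤ _
        positivity))
      (hi1.add hi2)
      ((ae_restrict_iff' hms).2 (Filter.Eventually.of_forall fun q hq =>
        h.pointwise_bound hq))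
    refine hmono.trans ?_
    rw [integral_add' hi1 hi2, integral_const_mul, integral_const_mul]
    exact add_le_of_nonpos_right
      (mul_nonpos_of_nonneg_of_nonpos (by positivity : 0 ≤ 4 * π / 3) hdiv)
  calc _ ≤ √((1 / 3) ^ 2 * ∫ q, (qdz Γ q.1 q.2) ^ 2 ∂(cylMeas R a)) := Real.sqrt_le_sqrt hmain
    _ = _ := by rw [Real.sqrt_mul (by positivity), Real.sqrt_sq (by norm_num)]
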